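/- arXiv:2410.15166 — 2 statements merged into one kernel-verified Lean document; each statement's English description precedes it below -/
import Mathlib

section
/- Bahadur representation (Theorem 2.1, pointwise/unconditional form): Let p be a probability mass function on {0,1}^M whose marginals satisfy 0 < α_j < 1 for every j ∈ {1,…,M}. Then for every y ∈ {0,1}^M, p(y) = (1 + Σ_{S ⊆ {1,…,M}, |S| ≥ 2} r_S · χ_S(y)) · ∏_{j=1}^M α_j^{y_j} (1 − α_j)^{1 − y_j}, where χ_S and the correlation coefficients r_S are computed with α equal to the marginals of p. -/
open Finset

/-- Standardized outcome `z_j(y, α) = (y_j − α_j)/√(α_j(1−α_j))`. -/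
noncomputable def zstd {M : ℕ} (α : Fin M → ℝ) (y : Fin M → Bool) (j : Fin M) : ℝ :=
  ((if y j then (1 : ℝ) else 0) - α j) / Real.sqrt (α j * (1 - α j))

/-- Basis function `χ_S(y) = ∏_{j ∈ S} z_j(y, α)`. -/
noncomputable def chi {M : ℕ} (α : Fin M → ℝ) (S : Finset (Fin M)) (y : Fin M → Bool) : ℝ :=
  ∏ j ∈ S, zstd α y j

/-- Product (independence) weight `p_I(y) = ∏_j α_j^{y_j} (1−α_j)^{1−y_j}`. -/
noncomputable def prodWeight {M : ℕ} (α : Fin M → ℝ) (y : Fin M → Bool) : ℝ :=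
  ∏ j, if y j then α j else 1 - α j

/-- Marginal probability `α_j = Σ_{y : y_j = 1} p(y)` of a pmf `p` on `{0,1}^M`. -/
noncomputable def marginal {M : ℕ} (p : (Fin M → Bool) → ℝ) (j : Fin M) : ℝ :=
  ∑ y : Fin M → Bool, if y j then p y else 0

/-- Correlation coefficient `r_S = Σ_y p(y) χ_S(y)`, computed with the marginals of `p`. -/
noncomputable def corrCoef {M : ℕ} (p : (Fin M → Bool) → ℝ) (S : Finset (Fin M)) : ℝ :=
  ∑ y : Fin M → Bool, p y * chi (marginal p) S y

lemma bahadur_kernel_one {M : ℕ} (α : Fin M → ℝ) (hα : ∀ j, 0 < α j ∧ α j < 1)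
    (x y : Fin M → Bool) (j : Fin M) :
    (1 + zstd α x j * zstd α y j) * (if y j then α j else 1 - α j) =
      if x j = y j then 1 else 0 := by
  obtain ⟨h0, h1⟩ := hα j
  have h2 : 0 < 1 - α j := by linarith
  have hs : Real.sqrt (α j * (1 - α j)) * Real.sqrt (α j * (1 - α j)) = α j * (1 - α j) :=
    Real.mul_self_sqrt (by positivity)
  unfold zstd
  rw [div_mul_div_comm, hs]
  cases x j <;> cases y j <;> simp [-mul_eq_zero] <;> field_simp <;> ring

lemma bahadur_kernel {M : ℕ} (α : Fin M → ℝ) (hα : ∀ j, 0 < α j ∧ α j < 1)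
    (x y : Fin M → Bool) :
    (∑ S : Finset (Fin M), chi α S x * chi α S y) * prodWeight α y =
      if x = y then 1 else 0 := by
  have h : (∑ S : Finset (Fin M), chi α S x * chi α S y) =
      ∏ j, (1 + zstd α x j * zstd α y j) := by
    rw [Finset.prod_one_add, Finset.powerset_univ]
    simp [chi, Finset.prod_mul_distrib]
  rw [h, prodWeight, ← Finset.prod_mul_distrib,
    Finset.prod_congr rfl (fun j _ => bahadur_kernel_one α hα x y j)]
  by_cases hxy : x = y
  · simp [hxy]
  · rw [if_neg hxy]
    obtain ⟨j, hj⟩ := Function.ne_iff.mp hxy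
    exact Finset.prod_eq_zero (Finset.mem_univ j) (if_neg hj)

lemma corrCoef_singleton {M : ℕ} (p : (Fin M → Bool) → ℝ)
    (hsum : ∑ y : Fin M → Bool, p y = 1) (j : Fin M) : corrCoef p {j} = 0 := by
  have h : ∀ y, p y * chi (marginal p) {j} y =
      ((if y j then p y else 0) - p y * marginal p j) /
        Real.sqrt (marginal p j * (1 - marginal p j)) := by
    intro y
    simp only [chi, Finset.prod_singleton, zstd]
    split_ifs <;> ring
  unfold corrCoef
  rw [Finset.sum_congr rfl (fun y _ => h y), ← Finset.sum_div, Finset.sum_sub_distrib,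
    ← Finset.sum_mul, hsum]
  change (marginal p j - 1 * marginal p j) / _ = 0
  simp

lemma corrCoef_full {M : ℕ} (p : (Fin M → Bool) → ℝ)
    (hα : ∀ j, 0 < marginal p j ∧ marginal p j < 1) (y : Fin M → Bool) :
    (∑ S : Finset (Fin M), corrCoef p S * chi (marginal p) S y) * prodWeight (marginal p) y
      = p y := by
  have h : (∑ S : Finset (Fin M), corrCoef p S * chi (marginal p) S y) =
      ∑ x, p x * ∑ S : Finset (Fin M), chi (marginal p) S x * chi (marginal p) S y := by
    simp only [corrCoef, Finset.sum_mul, Finset.mul_sum]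
    rw [Finset.sum_comm]
    simp only [mul_assoc]
  rw [h, Finset.sum_mul]
  simp only [mul_assoc, bahadur_kernel _ hα]
  simp

/-- Bahadur representation: for any pmf on `{0,1}^M` with marginals strictly between 0 and 1,
`p(y) = (1 + Σ_{|S| ≥ 2} r_S χ_S(y)) ∏_j α_j^{y_j}(1−α_j)^{1−y_j}`. -/
theorem bahadur_representation {M : ℕ} (hM : 0 < M)
    (p : (Fin M → Bool) → ℝ)
    (hp : ∀ y, 0 ≤ p y) (hsum : ∑ y : Fin M → Bool, p y = 1)
    (hα : ∀ j, 0 < marginal p j ∧ marginal p j < 1) :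
    ∀ y : Fin M → Bool,
      p y = (1 + ∑ S ∈ (Finset.univ : Finset (Finset (Fin M))).filter (fun S => 2 ≤ S.card),
          corrCoef p S * chi (marginal p) S y) * prodWeight (marginal p) y := by
  intro y
  rw [← corrCoef_full p hα y]
  congr 1
  rw [← Finset.sum_filter_add_sum_filter_not Finset.univ (fun S : Finset (Fin M) => 2 ≤ S.card),
    add_comm]
  congr 1
  rw [Finset.sum_eq_single ∅]
  · simp [corrCoef, chi, hsum]
  · intro S hS hne
    have h1 : S.card = 1 := by
      have := Finset.card_pos.mpr (Finset.nonempty_iff_ne_empty.mpr hne)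
      have h2 := (Finset.mem_filter.mp hS).2
      omega
    obtain ⟨j, rfl⟩ := Finset.card_eq_one.mp h1
    rw [corrCoef_singleton p hsum, zero_mul]
  · intro h
    simp at h
end

section
/- Cone (restricted set) condition for the ℓ1-penalized plug-in estimator (Lemma E.1): Let N, P ≥ 1 be integers, W_1, …, W_N ∈ ℝ^P, w ∈ ℝ^P with w_j > 0 for all j, λ > 0, and c > 1. Let r₀, r̂ ∈ ℝ^P satisfy 1 + W_i·r₀ > 0 and 1 + W_i·r̂ > 0 for all i ∈ {1,…,N}, and suppose r̂ is at least as good as r₀ for the penalized average log-likelihood: N^{-1} Σ_{i=1}^N log(1 + W_i·r̂) − λ‖r̂‖_{w,1} ≥ N^{-1} Σ_{i=1}^N log(1 + W_i·r₀) − λ‖r₀‖_{w,1}. If moreover the score bound | N^{-1} Σ_{i=1}^N W_{ij} / (1 + W_i·r₀) | ≤ (λ/c) w_j holds for every j ∈ {1,…,P}, then, writing ν = r̂ − r₀ and T = {j : r₀_j ≠ 0}, one has ‖ν_{T^c}‖_{w,1} ≤ ((c+1)/(c−1)) ‖ν_T‖_{w,1}, and consequently ‖ν‖_{w,1} ≤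 (2c/(c−1)) ‖ν_T‖_{w,1}. -/
open Finset

/-- Cone (restricted set) condition for the ℓ1-penalized plug-in estimator (Lemma E.1):
if `r̂` improves the penalized average log-likelihood over `r₀` and the score at `r₀`
is bounded by `λ w_j / c` componentwise, then `ν = r̂ − r₀` satisfies
`‖ν_{T^c}‖_{w,1} ≤ ((c+1)/(c−1)) ‖ν_T‖_{w,1}` and
`‖ν‖_{w,1} ≤ (2c/(c−1)) ‖ν_T‖_{w,1}`, where `T = supp(r₀)`. -/
theorem cone_condition {N P : ℕ} (hN : 1 ≤ N) (hP : 1 ≤ P)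
    (W : Fin N → Fin P → ℝ) (w : Fin P → ℝ) (hw : ∀ j, 0 < w j)
    (lam : ℝ) (hlam : 0 < lam) (c : ℝ) (hc : 1 < c)
    (r0 rhat : Fin P → ℝ)
    (hpos0 : ∀ i, 0 < 1 + ∑ j, W i j * r0 j)
    (hposhat : ∀ i, 0 < 1 + ∑ j, W i j * rhat j)
    (hopt : (∑ i, Real.log (1 + ∑ j, W i j * r0 j)) / N - lam * ∑ j, w j * |r0 j| ≤
            (∑ i, Real.log (1 + ∑ j, W i j * rhat j)) / N - lam * ∑ j, w j * |rhat j|)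
    (hscore : ∀ j, |(∑ i, W i j / (1 + ∑ k, W i k * r0 k)) / N| ≤ lam / c * w j) :
    (∑ j ∈ Finset.univ.filter (fun j => r0 j = 0), w j * |rhat j - r0 j|)
      ≤ (c + 1) / (c - 1) *
        ∑ j ∈ Finset.univ.filter (fun j => r0 j ≠ 0), w j * |rhat j - r0 j| ∧
    (∑ j, w j * |rhat j - r0 j|)
      ≤ 2 * c / (c - 1) *
        ∑ j ∈ Finset.univ.filter (fun j => r0 j ≠ 0), w j * |rhat j - r0 j| := by
  have hNp : (0:ℝ) < N := by exact_mod_cast hN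
  set A := ∑ j ∈ Finset.univ.filter (fun j => r0 j = 0), w j * |rhat j - r0 j| with hA
  set B := ∑ j ∈ Finset.univ.filter (fun j => r0 j ≠ 0), w j * |rhat j - r0 j| with hB
  have hAB : A + B = ∑ j, w j * |rhat j - r0 j| :=
    Finset.sum_filter_add_sum_filter_not _ _ _
  have h2 : ∑ j, w j * |r0 j| - ∑ j, w j * |rhat j| ≤ B - A := by
    rw [hA, hB, Finset.sum_filter, Finset.sum_filter, ← Finset.sum_sub_distrib,
      ← Finset.sum_sub_distrib]
    apply Finset.sum_le_sum
    intro j _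
    by_cases h : r0 j = 0
    · simp [h]
    · simp only [h, ne_eq, not_false_eq_true, if_true, if_false, sub_zero]
      rw [← mul_sub]
      apply mul_le_mul_of_nonneg_left _ (hw j).le
      rw [abs_sub_comm]
      exact abs_sub_abs_le_abs_sub _ _
  have hlog : ∀ i, Real.log (1 + ∑ j, W i j * rhat j) - Real.log (1 + ∑ j, W i j * r0 j)
      ≤ ∑ j, W i j / (1 + ∑ k, W i k * r0 k) * (rhat j - r0 j) := by
    intro i
    have hp := hpos0 i
    have hq := hposhat i
    have e : ∑ j, W i j / (1 + ∑ k, W i k * r0 k) * (rhat j - r0 j)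
        = (1 + ∑ j, W i j * rhat j) / (1 + ∑ j, W i j * r0 j) - 1 := by
      rw [div_sub_one hp.ne', add_sub_add_left_eq_sub, ← Finset.sum_sub_distrib,
        Finset.sum_div]
      apply Finset.sum_congr rfl
      intro j _
      ring
    rw [e, ← Real.log_div hq.ne' hp.ne']
    exact Real.log_le_sub_one_of_pos (div_pos hq hp)
  have h1 : (∑ i, Real.log (1 + ∑ j, W i j * rhat j)) / N
      - (∑ i, Real.log (1 + ∑ j, W i j * r0 j)) / N ≤ lam / c * (A + B) := by
    calc _ = (∑ i, (Real.log (1 + ∑ j, W i j * rhat j)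
              - Real.log (1 + ∑ j, W i j * r0 j))) / N := by
            rw [Finset.sum_sub_distrib, sub_div]
      _ ≤ (∑ i, ∑ j, W i j / (1 + ∑ k, W i k * r0 k) * (rhat j - r0 j)) / N :=
            div_le_div_of_nonneg_right (Finset.sum_le_sum fun i _ => hlog i) hNp.le
      _ = ∑ j, (∑ i, W i j / (1 + ∑ k, W i k * r0 k)) / N * (rhat j - r0 j) := by
            rw [Finset.sum_comm, Finset.sum_div]
            apply Finset.sum_congr rfl
            intro j _
            rw [← Finset.sum_mul]
            ring
      _ ≤ ∑ j, lam / c * (w j * |rhat j - r0 j|) := by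
            apply Finset.sum_le_sum
            intro j _
            refine (le_abs_self _).trans ?_
            rw [abs_mul, ← mul_assoc]
            exact mul_le_mul_of_nonneg_right (hscore j) (abs_nonneg _)
      _ = _ := by rw [hAB, Finset.mul_sum]
  have h3 : lam * (A - B) ≤ lam * ((A + B) / c) := by
    have := mul_le_mul_of_nonneg_left h2 hlam.le
    have e : lam / c * (A + B) = lam * ((A + B) / c) := by ring
    rw [e] at h1
    linarith
  have h4 := le_of_mul_le_mul_left h3 hlam
  rw [le_div_iff₀ (by linarith)] at h4
  have hc1 : 0 < c - 1 := by linarith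
  rw [← hAB]
  constructor
  · rw [div_mul_eq_mul_div, le_div_iff₀ hc1]
    linarith
  · rw [div_mul_eq_mul_div, le_div_iff₀ hc1]
    linarith
end
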